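/- Let a, s, r be nonnegative real numbers with a⁴ ≤ s⁴ + 2r⁴, let s_k > 0 with s_k ≤ s, and set τ̂ = r/s_k. Then a⁴ ≤ s⁴ · (1 + (2 + 4τ̂⁴) · (r/a)⁴) whenever a > 0; in particular s ≥ a / (1 + 2τ̂⁴)^{1/4}. -/

import Mathlib

/-- Scalar inequality underlying the Flip-Flop SRQR singular value lower
bound: if `a, s, r ≥ 0` with `a⁴ ≤ s⁴ + 2r⁴`, `0 < sₖ ≤ s`, and `τ̂ = r/sₖ`, then
`a⁴ ≤ s⁴(1 + (2 + 4τ̂⁴)(r/a)⁴)` whenever `a > 0`; in particular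
`s ≥ a/(1 + 2τ̂⁴)^{1/4}`. -/
theorem scalar_fourth_power_inequality
    (a s r sk τhat : ℝ) (ha : 0 ≤ a) (hs : 0 ≤ s) (hr : 0 ≤ r)
    (h : a ^ 4 ≤ s ^ 4 + 2 * r ^ 4)
    (hsk : 0 < sk) (hsks : sk ≤ s) (hτ : τhat = r / sk) :
    (0 < a → a ^ 4 ≤ s ^ 4 * (1 + (2 + 4 * τhat ^ 4) * (r / a) ^ 4)) ∧
    a / (1 + 2 * τhat ^ 4) ^ ((1 : ℝ) / 4) ≤ s := by
  have hT : 0 ≤ τhat ^ 4 := by positivity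
  have hrs : r ^ 4 ≤ τhat ^ 4 * s ^ 4 := by
    have hτ0 : 0 ≤ τhat := hτ ▸ div_nonneg hr hsk.le
    have hle : r ≤ τhat * s := by
      calc r = τhat * sk := by rw [hτ, div_mul_cancel₀ _ hsk.ne']
        _ ≤ τhat * s := mul_le_mul_of_nonneg_left hsks hτ0
    calc r ^ 4 ≤ (τhat * s) ^ 4 := pow_le_pow_left₀ hr hle 4
      _ = τhat ^ 4 * s ^ 4 := mul_pow _ _ _
  have has : a ^ 4 ≤ s ^ 4 * (1 + 2 * τhat ^ 4) := by linarith
  constructor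
  · intro ha0
    have hA : 0 < a ^ 4 := by positivity
    have hR : 0 ≤ r ^ 4 := by positivity
    have hmul : 2 * r ^ 4 * a ^ 4 ≤ s ^ 4 * (2 + 4 * τhat ^ 4) * r ^ 4 := by
      linarith [mul_le_mul_of_nonneg_left has hR]
    have hdiv : 2 * r ^ 4 ≤ s ^ 4 * (2 + 4 * τhat ^ 4) * r ^ 4 / a ^ 4 :=
      (le_div_iff₀ hA).mpr hmul
    calc a ^ 4 ≤ s ^ 4 + s ^ 4 * (2 + 4 * τhat ^ 4) * r ^ 4 / a ^ 4 := by linarith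
      _ = s ^ 4 * (1 + (2 + 4 * τhat ^ 4) * (r / a) ^ 4) := by rw [div_pow]; ring
  · have hpos : 0 < 1 + 2 * τhat ^ 4 := by linarith
    have hc : ((1 + 2 * τhat ^ 4) ^ ((1 : ℝ) / 4)) ^ 4 = 1 + 2 * τhat ^ 4 := by
      rw [← Real.rpow_natCast, ← Real.rpow_mul hpos.le]
      norm_num
    have hc0 : 0 < (1 + 2 * τhat ^ 4) ^ ((1 : ℝ) / 4) := Real.rpow_pos_of_pos hpos _
    rw [div_le_iff₀ hc0]
    refine le_of_pow_le_pow_left₀ (n := 4) (by norm_num) (by positivity) ?_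
    rw [mul_pow, hc]
    exact has
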